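/- arXiv:1012.4047 — 2 statements merged into one kernel-verified Lean document; each statement's English description precedes it below -/
import Mathlib

section
/- Let b be a nonnegative even integer and let k and m be positive integers with m ≥ 3. Then E_{2^m k + b} - E_b ≡ 2^m k (7(b+1)^2 - 18 + 2^m k (7 - b)) (mod 2^{m+7}). -/
/-- The Euler numbers `E n`, defined by `E 0 = 1`, `E (2n-1) = 0` for `n ≥ 1`,
and `∑_{r=0}^{n} C(2n, 2r) * E (2r) = 0` for `n ≥ 1`. -/
def eulerE : ℕ → ℤ
  | 0 => 1
  | 1 => 0
  | n + 2 =>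
      if Even n then
        -∑ r ∈ (Finset.range (n / 2 + 1)).attach,
          ((n + 2).choose (2 * r.1) : ℤ) * eulerE (2 * r.1)
      else 0
  decreasing_by
    have := r.2
    simp only [Finset.mem_range] at this
    omega

open Polynomial

theorem eulerE_odd (q : ℕ) : eulerE (2 * q + 1) = 0 := by
  cases q with
  | zero => rw [eulerE]
  | succ q =>
    rw [show 2 * (q + 1) + 1 = (2 * q + 1) + 2 by ring, eulerE, if_neg (by simp)]

theorem sum_range_choose_two_mul_mul_eulerE (q : ℕ) :
    ∑ r ∈ Finset.range (q + 2), ((2 * q + 2).choose (2 * r) : ℤ) * eulerE (2 * r) = 0 := by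
  rw [Finset.sum_range_succ, show 2 * (q + 1) = 2 * q + 2 by ring, eulerE, if_pos (by simp),
    Finset.sum_attach _ (fun r ↦ ((2 * q + 2).choose (2 * r) : ℤ) * eulerE (2 * r))]
  simp

theorem sum_range_two_mul_add_one_eq_sum_even (f : ℕ → ℤ) (hf : ∀ q, f (2 * q + 1) = 0) (q : ℕ) :
    ∑ k ∈ Finset.range (2 * q + 1), f k = ∑ r ∈ Finset.range (q + 1), f (2 * r) := by
  induction q with
  | zero => simp
  | succ q ih =>
    rw [show 2 * (q + 1) + 1 = 2 * q + 1 + 1 + 1 by ring, Finset.sum_range_succ,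
      Finset.sum_range_succ, ih, hf, Finset.sum_range_succ _ (q + 1)]
    simp [mul_add]

/-- The umbral evaluation `x ^ n ↦ E n`. -/
noncomputable def eulerEval : ℤ[X] →ₗ[ℤ] ℤ :=
  Polynomial.lsum fun n ↦ LinearMap.toSpanSingleton ℤ ℤ (eulerE n)

theorem eulerEval_X_pow (n : ℕ) : eulerEval (X ^ n) = eulerE n := by
  simp [eulerEval, ← monomial_one_right_eq_X_pow]

theorem eulerEval_intCast_mul (c : ℤ) (p : ℤ[X]) : eulerEval (c * p) = c * eulerEval p := by
  rw [← zsmul_eq_mul, map_smul, smul_eq_mul]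

theorem eulerEval_X_add_one_pow (n : ℕ) :
    eulerEval ((X + 1) ^ n) = ∑ k ∈ Finset.range (n + 1), (n.choose k : ℤ) * eulerE k := by
  rw [add_pow, map_sum]
  refine Finset.sum_congr rfl fun k _ ↦ ?_
  rw [← eulerEval_X_pow, ← eulerEval_intCast_mul]
  congr 1
  simp [mul_comm]

theorem eulerEval_X_sub_one_pow (n : ℕ) :
    eulerEval ((X - 1) ^ n) = (-1) ^ n * eulerEval ((X + 1) ^ n) := by
  rw [eulerEval_X_add_one_pow, sub_eq_add_neg, add_pow, map_sum, Finset.mul_sum]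
  refine Finset.sum_congr rfl fun k hk ↦ ?_
  have hkn : k ≤ n := Nat.lt_succ_iff.1 (Finset.mem_range.1 hk)
  have h : eulerEval (X ^ k * (-1) ^ (n - k) * (n.choose k : ℤ[X])) =
      (-1) ^ (n - k) * n.choose k * eulerE k := by
    rw [← eulerEval_X_pow, ← eulerEval_intCast_mul]
    congr 1
    push_cast
    ring
  rw [h]
  obtain ⟨q, rfl | rfl⟩ := k.even_or_odd'
  · obtain ⟨t, rfl⟩ := Nat.exists_eq_add_of_le hkn
    rw [Nat.add_sub_cancel_left, pow_add _ (2 * q) t, pow_mul]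
    ring
  · simp [eulerE_odd]

theorem eulerEval_comp_add_comp (p : ℤ[X]) :
    eulerEval (p.comp (X + 1)) + eulerEval (p.comp (X - 1)) = 2 * p.eval 0 := by
  induction p using Polynomial.induction_on' with
  | add p q hp hq =>
    simp only [add_comp, map_add, eval_add]
    linarith
  | monomial n a =>
    have h : eulerEval ((X + 1) ^ n) + eulerEval ((X - 1) ^ n) = 2 * 0 ^ n := by
      rw [eulerEval_X_sub_one_pow]
      obtain ⟨q, rfl | rfl⟩ := n.even_or_odd'
      · rw [eulerEval_X_add_one_pow, sum_range_two_mul_add_one_eq_sum_even _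
          (fun q ↦ by simp [eulerE_odd])]
        cases q with
        | zero => simp [eulerE]
        | succ q =>
          rw [show 2 * (q + 1) = 2 * q + 2 by ring, sum_range_choose_two_mul_mul_eulerE]
          simp
      · simp [pow_succ, pow_mul]
    rw [monomial_comp, monomial_comp, ← smul_eq_C_mul, ← smul_eq_C_mul, map_smul, map_smul,
      smul_eq_mul, smul_eq_mul, ← mul_add, h, eval_monomial]
    ring

/-- The product `∏ r, (x - r)` over the odd integers `r` with `|r| < 2 * i`. -/
noncomputable def oddNodes : ℕ → ℤ[X]
  | 0 => 1
  | i + 1 => oddNodes i * (X ^ 2 - (2 * (i : ℤ[X]) + 1) ^ 2)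

/-- The product `∏ r, (x - r)` over the even integers `r` with `|r| ≤ 2 * i`. -/
noncomputable def evenNodes : ℕ → ℤ[X]
  | 0 => X
  | i + 1 => evenNodes i * (X ^ 2 - (2 * (i : ℤ[X]) + 2) ^ 2)

theorem evenNodes_comp_X_add_one (i : ℕ) :
    (evenNodes i).comp (X + 1) = (X + (2 * (i : ℤ[X]) + 1)) * oddNodes i := by
  induction i with
  | zero => simp [evenNodes, oddNodes]
  | succ i ih =>
    simp only [evenNodes, oddNodes, mul_comp, sub_comp, add_comp, pow_comp, X_comp, natCast_comp,
      ofNat_comp, ih]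
    push_cast
    ring

theorem evenNodes_comp_X_sub_one (i : ℕ) :
    (evenNodes i).comp (X - 1) = (X - (2 * (i : ℤ[X]) + 1)) * oddNodes i := by
  induction i with
  | zero => simp [evenNodes, oddNodes]
  | succ i ih =>
    simp only [evenNodes, oddNodes, mul_comp, sub_comp, add_comp, pow_comp, X_comp, natCast_comp,
      ofNat_comp, ih]
    push_cast
    ring

theorem eulerEval_oddNodes (i : ℕ) :
    eulerEval (oddNodes i) = (-1) ^ i * (2 * i).factorial := by
  induction i with
  | zero => simpa [oddNodes, eulerE] using eulerEval_X_pow 0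
  | succ i ih =>
    have h := eulerEval_comp_add_comp (X * evenNodes i)
    rw [mul_comp, mul_comp, X_comp, X_comp, evenNodes_comp_X_add_one, evenNodes_comp_X_sub_one,
      ← map_add] at h
    have e : (X + 1) * ((X + (2 * (i : ℤ[X]) + 1)) * oddNodes i) +
        (X - 1) * ((X - (2 * (i : ℤ[X]) + 1)) * oddNodes i) =
        ((2 : ℤ) : ℤ[X]) * oddNodes (i + 1) +
          ((2 * ((2 * i + 1) * (2 * i + 2)) : ℤ) : ℤ[X]) * oddNodes i := by
      rw [oddNodes]
      push_cast
      ring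
    rw [e, map_add, eulerEval_intCast_mul, eulerEval_intCast_mul, ih] at h
    simp only [eval_mul, eval_X, zero_mul, mul_zero] at h
    rw [show 2 * (i + 1) = 2 * i + 1 + 1 by ring, Nat.factorial_succ, Nat.factorial_succ]
    push_cast
    have h2 : eulerEval (oddNodes (i + 1)) +
        (2 * i + 1) * (2 * i + 2) * ((-1) ^ i * (2 * i).factorial) = 0 := by
      linarith
    linear_combination h2

theorem eulerEval_oddNodes_mul_pow_succ (i j : ℕ) :
    eulerEval (oddNodes i * (X ^ 2 - 1) ^ (j + 1)) =
      eulerEval (oddNodes (i + 1) * (X ^ 2 - 1) ^ j) +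
        4 * (i * (i + 1)) * eulerEval (oddNodes i * (X ^ 2 - 1) ^ j) := by
  have e : oddNodes i * (X ^ 2 - 1) ^ (j + 1) = oddNodes (i + 1) * (X ^ 2 - 1) ^ j +
      ((4 * (i * (i + 1)) : ℤ) : ℤ[X]) * (oddNodes i * (X ^ 2 - 1) ^ j) := by
    rw [oddNodes]
    push_cast
    ring
  rw [e, map_add, eulerEval_intCast_mul]

theorem two_pow_dvd_factorial_two_mul (s : ℕ) (hs : 6 ≤ s) :
    2 ^ (s + 4) ∣ (2 * s).factorial := by
  induction s, hs using Nat.le_induction with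
  | base => decide
  | succ s hs ih =>
    rw [show 2 * (s + 1) = 2 * s + 1 + 1 by ring, Nat.factorial_succ, Nat.factorial_succ,
      show s + 1 + 4 = 1 + (s + 4) by ring, pow_add]
    refine mul_dvd_mul ?_ (ih.mul_left _)
    omega

theorem two_pow_min_dvd_factorial_two_mul (s : ℕ) :
    2 ^ min (s + 4) (2 * s - 2) ∣ (2 * s).factorial := by
  rcases le_or_gt 6 s with hs | hs
  · exact (pow_dvd_pow 2 (min_le_left _ _)).trans (two_pow_dvd_factorial_two_mul s hs)
  · interval_cases s <;> decide

theorem two_pow_min_dvd_eulerEval (i j : ℕ) :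
    (2 : ℤ) ^ min (i + j + 4) (2 * (i + j) - 2) ∣ eulerEval (oddNodes i * (X ^ 2 - 1) ^ j) := by
  induction j generalizing i with
  | zero =>
    rw [pow_zero, mul_one, eulerEval_oddNodes]
    exact Dvd.dvd.mul_left (by exact_mod_cast two_pow_min_dvd_factorial_two_mul i) _
  | succ j ih =>
    rw [eulerEval_oddNodes_mul_pow_succ]
    refine dvd_add ?_ ?_
    · have h := ih (i + 1)
      rwa [show i + 1 + j = i + (j + 1) by ring] at h
    · have h8 : (2 : ℤ) ^ 3 ∣ 4 * (i * (i + 1)) := by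
        obtain ⟨c, hc⟩ := (Int.even_mul_succ_self i).two_dvd
        exact ⟨c, by rw [hc]; ring⟩
      refine (pow_dvd_pow 2 ?_).trans ((pow_add (2 : ℤ) _ _).dvd.trans (mul_dvd_mul h8 (ih i)))
      omega

theorem two_pow_dvd_eulerEval_pow (j : ℕ) (hj : 6 ≤ j) :
    (2 : ℤ) ^ (j + 4) ∣ eulerEval ((X ^ 2 - 1) ^ j) := by
  have h := two_pow_min_dvd_eulerEval 0 j
  rw [oddNodes, one_mul] at h
  exact (pow_dvd_pow 2 (by omega)).trans h

theorem eulerE_two_mul (n M : ℕ) (h : n < M) :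
    eulerE (2 * n) = ∑ j ∈ Finset.range M, (n.choose j : ℤ) * eulerEval ((X ^ 2 - 1) ^ j) := by
  rw [← Finset.sum_subset (Finset.range_subset_range.2 h)
    (fun j _ hj ↦ by
      rw [Finset.mem_range, not_lt] at hj
      rw [Nat.choose_eq_zero_of_lt hj, Nat.cast_zero, zero_mul]),
    ← eulerEval_X_pow, pow_mul, show (X ^ 2 : ℤ[X]) = (X ^ 2 - 1) + 1 by ring, add_pow, map_sum]
  refine Finset.sum_congr rfl fun j _ ↦ ?_
  rw [← eulerEval_intCast_mul]
  congr 1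
  simp [mul_comm]

theorem two_pow_dvd_two_pow_mul_choose {s t d i : ℕ} (hd : 2 ^ s ∣ d) (hi : i ≠ 0)
    (hit : i < 2 ^ (t + 1)) : 2 ^ s ∣ 2 ^ t * d.choose i := by
  obtain ⟨v, u, hu, rfl⟩ := Nat.exists_eq_two_pow_mul_odd hi
  have hv : v ≤ t := by
    rw [← Nat.lt_succ_iff, ← Nat.pow_lt_pow_iff_right (one_lt_two)]
    exact (Nat.le_mul_of_pos_right _ hu.pos).trans_lt hit
  have h : 2 ^ s ∣ (2 ^ v * d.choose (2 ^ v * u)) * u := by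
    obtain ⟨c, hc⟩ := Nat.exists_eq_succ_of_ne_zero hi
    cases d with
    | zero => simp [hc]
    | succ d =>
      have := Nat.add_one_mul_choose_eq d c
      rw [← Nat.succ_eq_add_one c, ← hc] at this
      rw [mul_right_comm, mul_comm, ← this]
      exact hd.mul_right _
  have h' := (Nat.Coprime.pow_left s (Nat.coprime_two_left.2 hu)).dvd_of_dvd_mul_right h
  exact h'.trans (mul_dvd_mul_right (pow_dvd_pow 2 hv) _)

theorem two_pow_dvd_two_pow_mul_choose_add_sub {s t d j : ℕ} (n : ℕ) (hd : 2 ^ s ∣ d)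
    (hj : j < 2 ^ (t + 1)) :
    (2 : ℤ) ^ s ∣ 2 ^ t * (((n + d).choose j : ℤ) - n.choose j) := by
  have h : ((n + d).choose j : ℤ) - n.choose j =
      ∑ i ∈ Finset.range j, (d.choose (i + 1) * n.choose (j - (i + 1)) : ℤ) := by
    rw [add_comm n d, Nat.add_choose_eq, Finset.Nat.sum_antidiagonal_eq_sum_range_succ_mk,
      Finset.sum_range_succ']
    simp
  rw [h, Finset.mul_sum]
  refine Finset.dvd_sum fun i hi ↦ ?_
  rw [← mul_assoc]
  refine Dvd.dvd.mul_right ?_ _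
  rw [Finset.mem_range] at hi
  exact_mod_cast two_pow_dvd_two_pow_mul_choose hd i.succ_ne_zero (by omega)

theorem eulerE_two_mul_add_sub_modEq (n : ℕ) {d s : ℕ} (hd : 2 ^ s ∣ d) :
    eulerE (2 * (n + d)) - eulerE (2 * n) ≡ ∑ j ∈ Finset.range 6,
      (((n + d).choose j : ℤ) - n.choose j) * eulerEval ((X ^ 2 - 1) ^ j) [ZMOD 2 ^ (s + 8)] := by
  rw [eulerE_two_mul (n + d) (6 + (n + d)) (by omega), eulerE_two_mul n (6 + (n + d)) (by omega),
    ← Finset.sum_sub_distrib]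
  simp only [← sub_mul]
  rw [Finset.sum_range_add]
  refine Int.modEq_iff_dvd.2 ?_
  rw [sub_add_cancel_left, dvd_neg]
  refine Finset.dvd_sum fun i _ ↦ ?_
  obtain ⟨c, hc⟩ := two_pow_dvd_eulerEval_pow (6 + i) (by omega)
  have hi : 6 + i < 2 ^ (2 + i + 1) := by
    have := Nat.lt_two_pow_self (n := i)
    rw [show 2 + i + 1 = i + 3 by ring, pow_add]
    omega
  obtain ⟨e, he⟩ := two_pow_dvd_two_pow_mul_choose_add_sub n hd hi
  refine ⟨e * c, ?_⟩
  rw [hc, pow_add _ s, show 6 + i + 4 = 2 + i + 8 by ring, pow_add _ (2 + i) 8]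
  linear_combination 2 ^ 8 * c * he

theorem factorial_mul_choose_eq_eval (N j : ℕ) :
    (j.factorial : ℤ) * N.choose j = (descPochhammer ℤ j).eval (N : ℤ) := by
  rw [descPochhammer_eval_eq_descFactorial, Nat.descFactorial_eq_factorial_mul_choose]
  push_cast
  rfl

theorem eulerEval_X_sq_sub_one_pow_le_five :
    eulerEval ((X ^ 2 - 1) ^ 0) = 1 ∧ eulerEval ((X ^ 2 - 1) ^ 1) = -2 ∧
    eulerEval ((X ^ 2 - 1) ^ 2) = 8 ∧ eulerEval ((X ^ 2 - 1) ^ 3) = -80 ∧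
    eulerEval ((X ^ 2 - 1) ^ 4) = 1664 ∧ eulerEval ((X ^ 2 - 1) ^ 5) = -58112 := by
  have h (j : ℕ) : eulerEval ((X ^ 2 - 1) ^ j) = eulerEval (oddNodes 0 * (X ^ 2 - 1) ^ j) := by
    rw [oddNodes, one_mul]
  have h0 (i : ℕ) : eulerEval (oddNodes i * (X ^ 2 - 1) ^ 0) = (-1) ^ i * (2 * i).factorial := by
    rw [pow_zero, mul_one, eulerEval_oddNodes]
  have hs := eulerEval_oddNodes_mul_pow_succ
  simp only [h]
  generalize hA : (fun i j ↦ eulerEval (oddNodes i * (X ^ 2 - 1) ^ j)) = A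
  simp only [congrFun₂ hA] at h0 hs ⊢
  norm_num [hs, h0, Nat.factorial]

theorem fifteen_mul_sum_choose_mul_eulerEval (n : ℕ) :
    15 * ∑ j ∈ Finset.range 6, (n.choose j : ℤ) * eulerEval ((X ^ 2 - 1) ^ j) =
      15 - 30 * n + 60 * (n * (n - 1)) - 200 * (n * (n - 1) * (n - 2)) +
        1040 * (n * (n - 1) * (n - 2) * (n - 3)) -
        7264 * (n * (n - 1) * (n - 2) * (n - 3) * (n - 4)) := by
  obtain ⟨h0, h1, h2, h3, h4, h5⟩ := eulerEval_X_sq_sub_one_pow_le_five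
  simp only [Finset.sum_range_succ, Finset.sum_range_zero, h0, h1, h2, h3, h4, h5]
  have c2 := factorial_mul_choose_eq_eval n 2
  have c3 := factorial_mul_choose_eq_eval n 3
  have c4 := factorial_mul_choose_eq_eval n 4
  have c5 := factorial_mul_choose_eq_eval n 5
  simp [descPochhammer_succ_right, Nat.factorial] at c2 c3 c4 c5
  push_cast [Nat.choose_zero_right, Nat.choose_one_right]
  linear_combination 60 * c2 - 200 * c3 + 1040 * c4 - 7264 * c5

theorem dvd_sum_choose_sub_sub (n : ℕ) {d : ℕ} (hd : 4 ∣ d) :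
    (d * 256 : ℤ) ∣ 15 * (∑ j ∈ Finset.range 6,
      (((n + d).choose j : ℤ) - n.choose j) * eulerEval ((X ^ 2 - 1) ^ j) -
        2 * d * (7 * (2 * n + 1) ^ 2 - 18 + 2 * d * (7 - 2 * n))) := by
  simp only [sub_mul _ _ (eulerEval _), Finset.sum_sub_distrib]
  have h1 := fifteen_mul_sum_choose_mul_eulerEval n
  have h2 := fifteen_mul_sum_choose_mul_eulerEval (n + d)
  obtain ⟨e, rfl⟩ := hd
  obtain ⟨p, hp⟩ := (Int.even_mul_succ_self n).two_dvd
  obtain ⟨q, hq⟩ := (Int.even_mul_pred_self p).two_dvd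
  obtain ⟨r, hr⟩ := (Int.even_mul_succ_self e).two_dvd
  rw [mul_sub, mul_sub, h1, h2]
  push_cast
  refine ⟨q + r + p * e + (-706 + 5857 * e - 16293 * e ^ 2 + 18420 * e ^ 3 - 7264 * e ^ 4 +
    2929 * n - 12218 * n * e + 18420 * n * e ^ 2 - 9080 * n * e ^ 3 - 3058 * n ^ 2 +
    6907 * n ^ 2 * e - 4540 * n ^ 2 * e ^ 2 + 1151 * n ^ 3 - 1135 * n ^ 3 * e - 142 * n ^ 4), ?_⟩
  linear_combination (4 * e * 32) * (n * (n + 1) - 2 + 2 * p) * hp + 4 * e * 128 * hq +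
    4 * e * 128 * hr + 4 * e * 128 * e * hp

theorem stern_ext_m_ge_three (b k m : ℕ) (hb : Even b) (hk : 0 < k) (hm : 3 ≤ m) :
    eulerE (2 ^ m * k + b) - eulerE b ≡
      2 ^ m * k * (7 * ((b : ℤ) + 1) ^ 2 - 18 + 2 ^ m * k * (7 - b)) [ZMOD 2 ^ (m + 7)] := by
  obtain ⟨n, rfl⟩ := hb.two_dvd
  obtain ⟨s, rfl⟩ : ∃ s, m = s + 1 := ⟨m - 1, by omega⟩
  have h4 : 4 ∣ 2 ^ s * k := (pow_dvd_pow 2 (show 2 ≤ s by omega)).mul_right k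
  have h := eulerE_two_mul_add_sub_modEq n (dvd_mul_right (2 ^ s) k)
  rw [show 2 ^ (s + 1) * k + 2 * n = 2 * (n + 2 ^ s * k) by ring,
    show s + 1 + 7 = s + 8 by ring]
  refine h.trans (Int.ModEq.symm (Int.modEq_iff_dvd.2 ?_))
  have hdvd := dvd_sum_choose_sub_sub n h4
  have hcop : IsCoprime ((2 : ℤ) ^ (s + 8)) 15 :=
    IsCoprime.pow_left ⟨-7, 1, by norm_num⟩
  refine hcop.dvd_of_dvd_mul_left (Dvd.dvd.trans ⟨k, ?_⟩ (hdvd.trans (dvd_of_eq ?_)))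
  · push_cast
    ring
  · push_cast
    ring
end

section
/- Let k and m be positive integers with m ≥ 2. If m = 2 then E_{4k} ≡ 4k(-48k^2 + 60k - 11) + 1 (mod 2^{9}), and if m ≥ 3 then E_{2^m k} ≡ 2^m k(-11 + 7·2^m k) + 1 (mod 2^{m+7}). -/
open Polynomial in
/-- The linear functional on integer polynomials that sends `X ^ n` to `eulerE n`. -/
noncomputable def eulerFunctional : ℤ[X] →ₗ[ℤ] ℤ :=
  Polynomial.lsum fun n => LinearMap.mulRight ℤ (eulerE n)

open Polynomial in
lemma eulerFunctional_monomial (n : ℕ) (a : ℤ) :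
    eulerFunctional (monomial n a) = a * eulerE n := by
  simp [eulerFunctional, Polynomial.lsum_apply]

open Polynomial in
lemma eulerFunctional_X_pow (n : ℕ) : eulerFunctional (X ^ n) = eulerE n := by
  rw [← monomial_one_right_eq_X_pow, eulerFunctional_monomial, one_mul]

lemma eulerE_zero : eulerE 0 = 1 := by rw [eulerE]

lemma eulerE_of_odd {n : ℕ} (hn : Odd n) : eulerE n = 0 := by
  match n, hn with
  | 0, h => simp at h
  | 1, _ => rw [eulerE]
  | n + 2, h =>
    rw [eulerE, if_neg]
    rw [Nat.not_even_iff_odd]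
    rcases h with ⟨c, hc⟩
    exact ⟨c - 1, by omega⟩

lemma sum_choose_two_mul_eulerE {n : ℕ} (hn : 0 < n) :
    ∑ r ∈ Finset.range (n + 1), ((2 * n).choose (2 * r) : ℤ) * eulerE (2 * r) = 0 := by
  obtain ⟨n, rfl⟩ : ∃ c, n = c + 1 := ⟨n - 1, by omega⟩
  rw [Finset.sum_range_succ]
  have h : eulerE (2 * (n + 1)) =
      -∑ r ∈ Finset.range (n + 1), ((2 * (n + 1)).choose (2 * r) : ℤ) * eulerE (2 * r) := by
    rw [mul_add, mul_one, eulerE, if_pos (even_two_mul n),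
      Finset.sum_attach (Finset.range (2 * n / 2 + 1))
        (fun r => ((2 * n + 2).choose (2 * r) : ℤ) * eulerE (2 * r))]
    simp
  simp [h]

lemma eulerE_two : eulerE 2 = -1 := by
  have h := sum_choose_two_mul_eulerE one_pos
  simp [Finset.sum_range_succ, eulerE_zero] at h
  linarith

lemma eulerE_four : eulerE 4 = 5 := by
  have h := sum_choose_two_mul_eulerE two_pos
  simp [Finset.sum_range_succ, eulerE_zero, eulerE_two, Nat.choose] at h
  linarith

lemma Finset.sum_range_two_mul_add_one_of_odd_eq_zero {M : Type*} [AddCommMonoid M]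
    (f : ℕ → M) (hf : ∀ i, Odd i → f i = 0) (n : ℕ) :
    ∑ i ∈ Finset.range (2 * n + 1), f i = ∑ i ∈ Finset.range (n + 1), f (2 * i) := by
  induction n with
  | zero => simp
  | succ n ih =>
    rw [Finset.sum_range_succ _ (n + 1), ← ih, mul_add, mul_one, Finset.sum_range_succ,
      Finset.sum_range_succ _ (2 * n + 1), hf (2 * n + 1) (odd_two_mul_add_one n), add_zero]

open Polynomial in
lemma eulerFunctional_X_add_C_pow (n : ℕ) (a : ℤ) :
    eulerFunctional ((X + C a) ^ n) =
      ∑ r ∈ Finset.range (n + 1), a ^ (n - r) * (n.choose r : ℤ) * eulerE r := by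
  rw [add_pow, map_sum]
  refine Finset.sum_congr rfl fun r _ => ?_
  have : (X ^ r * C a ^ (n - r) * (n.choose r : ℤ[X]) : ℤ[X]) =
      monomial r (a ^ (n - r) * (n.choose r : ℤ)) := by
    rw [← C_mul_X_pow_eq_monomial]
    simp
    ring
  rw [this, eulerFunctional_monomial]

open Polynomial in
lemma eulerFunctional_comp_add_comp_sub (p : ℤ[X]) :
    eulerFunctional (p.comp (X + C 1)) + eulerFunctional (p.comp (X + C (-1))) =
      2 * p.eval 0 := by
  induction p using Polynomial.induction_on' with
  | add p q hp hq => simp only [add_comp, map_add, eval_add]; linarith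
  | monomial n a =>
    have key : eulerFunctional ((X + C 1) ^ n) + eulerFunctional ((X + C (-1)) ^ n) =
        2 * (0 : ℤ) ^ n := by
      rw [eulerFunctional_X_add_C_pow, eulerFunctional_X_add_C_pow, ← Finset.sum_add_distrib]
      rcases Nat.even_or_odd' n with ⟨c, rfl | rfl⟩
      · rw [Finset.sum_range_two_mul_add_one_of_odd_eq_zero _
          fun i hi => by simp [eulerE_of_odd hi]]
        rcases Nat.eq_zero_or_pos c with rfl | hc
        · simp [eulerE_zero]
        · have h := sum_choose_two_mul_eulerE hc
          rw [zero_pow (by omega), mul_zero, ← mul_zero 2, ← h, Finset.mul_sum]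
          refine Finset.sum_congr rfl fun r _ => ?_
          rw [← Nat.mul_sub, pow_mul, pow_mul]
          simp
          ring
      · rw [zero_pow (by omega), mul_zero]
        refine Finset.sum_eq_zero fun r hr => ?_
        rcases Nat.even_or_odd r with he | ho
        · have : Odd (2 * c + 1 - r) :=
            Nat.Odd.sub_even (by simp at hr; omega) (odd_two_mul_add_one c) he
          rw [this.neg_one_pow]
          simp
        · simp [eulerE_of_odd ho]
    rw [← C_mul_X_pow_eq_monomial]
    simp only [mul_comp, C_comp, pow_comp, X_comp, eval_mul, eval_C, eval_pow, eval_X]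
    simp only [← smul_eq_C_mul, map_smul, smul_eq_mul]
    rw [← mul_add, key]
    ring

open Polynomial in
lemma eulerFunctional_comp_neg (p : ℤ[X]) :
    eulerFunctional (p.comp (-X)) = eulerFunctional p := by
  induction p using Polynomial.induction_on' with
  | add p q hp hq => simp only [add_comp, map_add, hp, hq]
  | monomial n a =>
    rw [← C_mul_X_pow_eq_monomial]
    simp only [mul_comp, C_comp, pow_comp, X_comp]
    simp only [← smul_eq_C_mul, map_smul, smul_eq_mul]
    rcases Nat.even_or_odd n with he | ho
    · rw [he.neg_pow]
    · rw [ho.neg_pow, map_neg, eulerFunctional_X_pow, eulerE_of_odd ho, neg_zero]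

open Polynomial in
/-- A regularization of `eulerFunctional` by the factor `3`. -/
noncomputable def eulerFunctionalReg (p : ℤ[X]) : ℤ :=
  eulerFunctional (p.comp (3 * X + 2)) + eulerFunctional (p.comp (3 * X))

open Polynomial in
lemma eulerFunctionalReg_add (p q : ℤ[X]) :
    eulerFunctionalReg (p + q) = eulerFunctionalReg p + eulerFunctionalReg q := by
  simp only [eulerFunctionalReg, add_comp, map_add]; ring

open Polynomial in
lemma eulerFunctionalReg_sub (p q : ℤ[X]) :
    eulerFunctionalReg (p - q) = eulerFunctionalReg p - eulerFunctionalReg q := by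
  simp only [eulerFunctionalReg, sub_comp, map_sub]; ring

open Polynomial in
lemma eulerFunctionalReg_C_mul (a : ℤ) (p : ℤ[X]) :
    eulerFunctionalReg (C a * p) = a * eulerFunctionalReg p := by
  simp only [eulerFunctionalReg, mul_comp, C_comp]
  simp only [← smul_eq_C_mul, map_smul, smul_eq_mul]
  ring

open Polynomial in
lemma eulerFunctionalReg_comp_shift (p : ℤ[X]) :
    eulerFunctionalReg (p.comp (X + 4)) - eulerFunctionalReg (p.comp (X + 2)) +
      eulerFunctionalReg p = 2 * p.eval 3 := by
  have h := eulerFunctional_comp_add_comp_sub (p.comp (3 * X + 3))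
  simp only [comp_assoc, eval_comp] at h
  have e1 : (3 * X + 3 : ℤ[X]).comp (X + C 1) = 3 * X + 6 := by simp; ring
  have e2 : (3 * X + 3 : ℤ[X]).comp (X + C (-1)) = 3 * X := by simp; ring
  rw [e1, e2] at h
  have a1 : (X + 4 : ℤ[X]).comp (3 * X + 2) = 3 * X + 6 := by simp; ring
  have a2 : (X + 4 : ℤ[X]).comp (3 * X) = 3 * X + 4 := by simp
  have a3 : (X + 2 : ℤ[X]).comp (3 * X + 2) = 3 * X + 4 := by simp; ring
  have a4 : (X + 2 : ℤ[X]).comp (3 * X) = 3 * X + 2 := by simp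
  simp only [eulerFunctionalReg, comp_assoc, a1, a2, a3, a4]
  simp at h
  linarith


open Polynomial in
lemma degree_comp_X_add_C_sub_lt {p : ℤ[X]} (hp : p ≠ 0) (a : ℤ) :
    (p.comp (X + C a) - p).degree < p.degree := by
  rw [← taylor_apply]
  have h := degree_sub_lt_left (p := taylor a p) (q := p) (by simp) (by simpa using hp) (by simp)
  simpa using h

open Polynomial in
lemma addMonoidHom_eq_zero_of_comp_add_comp_sub (φ : ℤ[X] →+ ℤ)
    (hφ : ∀ p : ℤ[X], φ (p.comp (X + C 1)) + φ (p.comp (X + C (-1))) = 0) (p : ℤ[X]) :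
    φ p = 0 := by
  induction h : p.degree using WellFoundedLT.induction generalizing p with
  | ind d ih =>
    subst h
    rcases eq_or_ne p 0 with rfl | hp
    · simp
    have h1 := ih _ (degree_comp_X_add_C_sub_lt hp 1) _ rfl
    have h2 := ih _ (degree_comp_X_add_C_sub_lt hp (-1)) _ rfl
    have h3 := hφ p
    rw [map_sub] at h1 h2
    linarith

open Polynomial in
lemma eulerFunctional_eq_triplication (p : ℤ[X]) :
    eulerFunctional p = eulerFunctional (p.comp (3 * X + 2)) - eulerFunctional (p.comp (3 * X)) +
      eulerFunctional (p.comp (3 * X - 2)) := by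
  let φ : ℤ[X] →+ ℤ :=
    { toFun := fun p => eulerFunctional p - (eulerFunctional (p.comp (3 * X + 2)) -
        eulerFunctional (p.comp (3 * X)) + eulerFunctional (p.comp (3 * X - 2)))
      map_zero' := by simp
      map_add' := fun p q => by simp only [add_comp, map_add]; ring }
  refine sub_eq_zero.mp (addMonoidHom_eq_zero_of_comp_add_comp_sub φ (fun q => ?_) p)
  have h := eulerFunctional_comp_add_comp_sub q
  have h' := eulerFunctional_comp_add_comp_sub (q.comp (3 * X))
  simp only [comp_assoc, eval_comp] at h'
  have a1 : (3 * X : ℤ[X]).comp (X + C 1) = 3 * X + 3 := by simp; ring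
  have a2 : (3 * X : ℤ[X]).comp (X + C (-1)) = 3 * X - 3 := by simp; ring
  have b1 : (X + C 1 : ℤ[X]).comp (3 * X + 2) = 3 * X + 3 := by simp; ring
  have b2 : (X + C 1 : ℤ[X]).comp (3 * X) = 3 * X + 1 := by simp
  have b3 : (X + C 1 : ℤ[X]).comp (3 * X - 2) = 3 * X - 1 := by simp; ring
  have c1 : (X + C (-1) : ℤ[X]).comp (3 * X + 2) = 3 * X + 1 := by simp; ring
  have c2 : (X + C (-1) : ℤ[X]).comp (3 * X) = 3 * X - 1 := by simp; ring
  have c3 : (X + C (-1) : ℤ[X]).comp (3 * X - 2) = 3 * X - 3 := by simp; ring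
  rw [a1, a2] at h'
  simp only [φ, AddMonoidHom.coe_mk, ZeroHom.coe_mk, comp_assoc, b1, b2, b3, c1, c2, c3]
  simp at h'
  linarith

open Polynomial in
lemma two_mul_eulerFunctionalReg_X_pow {n : ℕ} (hn : Even n) :
    2 * eulerFunctionalReg (X ^ n) = (1 + 3 ^ (n + 1)) * eulerE n := by
  have h := eulerFunctional_eq_triplication (X ^ n)
  have h2 := eulerFunctional_comp_neg ((X ^ n : ℤ[X]).comp (3 * X + 2))
  have h3 : ((X ^ n : ℤ[X]).comp (3 * X + 2)).comp (-X) = (X ^ n : ℤ[X]).comp (3 * X - 2) := by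
    simp only [pow_comp, X_comp, add_comp, mul_comp, ofNat_comp]
    rw [← hn.neg_pow]
    ring
  have h4 : eulerFunctional ((X ^ n : ℤ[X]).comp (3 * X)) = 3 ^ n * eulerE n := by
    have : (X ^ n : ℤ[X]).comp (3 * X) = C (3 ^ n) * X ^ n := by simp [mul_pow]
    rw [this, ← smul_eq_C_mul, map_smul, eulerFunctional_X_pow, smul_eq_mul]
  rw [h3] at h2
  rw [h2, h4, eulerFunctional_X_pow] at h
  rw [eulerFunctionalReg, h4]
  linear_combination -h

open Polynomial in
lemma two_mul_dvd_eulerFunctionalReg (d : ℤ) (p : ℤ[X])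
    (hp : ∀ z : ℤ, d ∣ p.eval (2 * z + 1)) : 2 * d ∣ eulerFunctionalReg p := by
  induction h : p.degree using WellFoundedLT.induction generalizing p with
  | ind e ih =>
    subst h
    rcases eq_or_ne p 0 with rfl | hp0
    · simp [eulerFunctionalReg]
    have hd (a : ℤ) :
        2 * d ∣ eulerFunctionalReg (p.comp (X + C (2 * a))) - eulerFunctionalReg p := by
      rw [← eulerFunctionalReg_sub]
      refine ih _ (degree_comp_X_add_C_sub_lt hp0 (2 * a)) _ (fun z => ?_) rfl
      rw [eval_sub, eval_comp]
      refine dvd_sub ?_ (hp z)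
      rw [show (X + C (2 * a) : ℤ[X]).eval (2 * z + 1) = 2 * (z + a) + 1 by simp; ring]
      exact hp (z + a)
    have h1 := hd 1
    have h2 := hd 2
    have h3 := mul_dvd_mul_left 2 (hp 1)
    have h4 := eulerFunctionalReg_comp_shift p
    norm_num at h1 h2 h3
    rw [← h4] at h3
    have h5 := dvd_sub (dvd_add h3 h1) h2
    ring_nf at h5 ⊢
    exact h5

lemma Nat.dvd_choose_mul_of_dvd {d u : ℕ} (hu : d ∣ u) (j : ℕ) : d ∣ u.choose j * j := by
  rcases j with _ | j
  · simp
  rcases u with _ | u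
  · simp
  · rw [← Nat.add_one_mul_choose_eq]
    exact hu.mul_right _

lemma two_pow_dvd_eight_pow_mul_choose {a u j : ℕ} (hu : 2 ^ a ∣ u) (hj : 4 ≤ j) :
    2 ^ (a + 10) ∣ 8 ^ j * u.choose j := by
  obtain ⟨v, c, hc, hjc⟩ := Nat.exists_eq_two_pow_mul_odd (n := j) (by omega)
  have h1 : 2 ^ a ∣ 2 ^ v * u.choose j := by
    refine (Nat.Coprime.pow_left a (Nat.coprime_two_left.mpr hc)).dvd_of_dvd_mul_right ?_
    have h := Nat.dvd_choose_mul_of_dvd hu j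
    have h2 : u.choose j * j = 2 ^ v * u.choose j * c := by
      rw [mul_right_comm, ← hjc, mul_comm]
    rwa [h2] at h
  have hv : v + 10 ≤ 3 * j := by
    have : 2 ^ v ≤ j := by
      rw [hjc]
      exact Nat.le_mul_of_pos_right _ hc.pos
    have := Nat.lt_two_pow_self (n := v)
    rcases hj.eq_or_lt with rfl | hj
    · have : v < 3 := by
        by_contra! h
        have := Nat.pow_le_pow_right two_pos h
        omega
      omega
    · omega
  obtain ⟨t, ht⟩ := Nat.exists_eq_add_of_le hv
  rw [show 8 = 2 ^ 3 by rfl, ← pow_mul, ht, show v + 10 + t = v + (10 + t) by ring]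
  have h2 : 2 ^ 10 ∣ 2 ^ (10 + t) := pow_dvd_pow 2 (by omega)
  have h3 := mul_dvd_mul h1 h2
  rwa [mul_right_comm, ← pow_add, ← pow_add] at h3

lemma one_add_eight_mul_pow_modEq {a u : ℕ} (hu : 2 ^ a ∣ u) (y : ℤ) :
    (1 + 8 * y) ^ u ≡ 1 + 8 * y * u + (8 * y) ^ 2 * u.choose 2 + (8 * y) ^ 3 * u.choose 3
      [ZMOD 2 ^ (a + 10)] := by
  have h : (1 + 8 * y) ^ u = ∑ j ∈ Finset.range (4 + u), (8 * y) ^ j * (u.choose j : ℤ) := by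
    rw [add_comm, add_pow]
    simp only [one_pow, mul_one]
    refine Finset.sum_subset (by simp) fun j _ hj => ?_
    rw [Nat.choose_eq_zero_of_lt (by simpa using hj)]
    simp
  rw [h, Finset.sum_range_add]
  have h0 : ∑ j ∈ Finset.range u, (8 * y) ^ (4 + j) * (u.choose (4 + j) : ℤ) ≡ 0
      [ZMOD 2 ^ (a + 10)] := by
    rw [Int.modEq_zero_iff_dvd]
    refine Finset.dvd_sum fun j _ => ?_
    have := two_pow_dvd_eight_pow_mul_choose hu (j := 4 + j) (by omega)
    have := (Int.natCast_dvd_natCast.mpr this).mul_right (y ^ (4 + j))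
    push_cast at this
    rw [mul_pow, mul_right_comm]
    exact this
  refine (h0.add_left _).trans ?_
  simp [Finset.sum_range_succ]

open Polynomial in
lemma regularized_eulerE_modEq {a u : ℕ} (hu : 2 ^ a ∣ u) :
    (1 + 3 ^ (2 * u + 1)) * eulerE (2 * u) ≡ 4 - 32 * u + 1280 * u.choose 2
      [ZMOD 2 ^ (a + 10)] := by
  have h := two_mul_dvd_eulerFunctionalReg (2 ^ (a + 8))
    (X ^ (2 * u) - 1 - C (u : ℤ) * (X ^ 2 - 1) - C (u.choose 2 : ℤ) * (X ^ 4 - C 2 * X ^ 2 + 1))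
    (fun z => by
      obtain ⟨y, hy⟩ := Int.even_mul_succ_self z
      have h1 := (one_add_eight_mul_pow_modEq hu y).symm.dvd
      have h2 := ((pow_dvd_pow (2 : ℤ) (show a + 8 ≤ a + 10 by omega)).trans h1)
      have h3 : 2 ^ a ∣ u.choose 3 :=
        (Nat.Coprime.pow_left a (by norm_num)).dvd_of_dvd_mul_right
          (Nat.dvd_choose_mul_of_dvd hu 3)
      obtain ⟨b, hb⟩ := Int.natCast_dvd_natCast.mpr h3
      obtain ⟨c, hc⟩ := h2
      have hx : (2 * z + 1) ^ 2 = 1 + 8 * y := by linear_combination 4 * hy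
      have hx4 : (2 * z + 1) ^ 4 = (1 + 8 * y) ^ 2 := by rw [← hx]; ring
      simp only [eval_sub, eval_add, eval_mul, eval_pow, eval_X, eval_C, eval_one, pow_mul,
        hx, hx4]
      refine ⟨c + 2 * y ^ 3 * b, ?_⟩
      push_cast at hb
      linear_combination hc + 512 * y ^ 3 * hb)
  have h0 := two_mul_eulerFunctionalReg_X_pow Even.zero
  have h2 := two_mul_eulerFunctionalReg_X_pow even_two
  have h4 := two_mul_eulerFunctionalReg_X_pow (n := 4) (by decide)
  have hn := two_mul_eulerFunctionalReg_X_pow (even_two_mul u)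
  rw [eulerE_zero, pow_zero] at h0
  rw [eulerE_two] at h2
  rw [eulerE_four] at h4
  simp only [eulerFunctionalReg_sub, eulerFunctionalReg_add, eulerFunctionalReg_C_mul] at h
  obtain ⟨c, hc⟩ := h
  refine (Int.modEq_iff_dvd.mpr ⟨c, ?_⟩).symm
  rw [← hn]
  linear_combination 2 * hc + (1 - (u : ℤ) + u.choose 2) * h0 + (u - 2 * u.choose 2) * h2
    + u.choose 2 * h4

lemma mul_eulerE_modEq {a u : ℕ} (hu : 2 ^ a ∣ u) :
    (1 + 6 * u + 24 * u * (u - 1) + 64 * u * (u - 1) * (u - 2)) * eulerE (2 * u) ≡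
      1 - 8 * u + 160 * u * (u - 1) [ZMOD 2 ^ (a + 8)] := by
  have h1 := (one_add_eight_mul_pow_modEq hu 1).mul_left 3 |>.add_left 1
    |>.mul_right (eulerE (2 * u))
  have h2 := regularized_eulerE_modEq hu
  have e2 : (u.choose 2 : ℤ) * 2 = u * (u - 1) := by
    have h := Nat.cast_choose_two ℚ u
    qify
    rw [h]
    ring
  have e3 : (u.choose 3 : ℤ) * 6 = u * (u - 1) * (u - 2) := by
    have h := Nat.choose_succ_right_eq u 2
    rcases Nat.lt_or_ge u 2 with hu | hu
    · interval_cases u <;> simp [Nat.choose]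
    · zify [hu] at h
      linear_combination 2 * h + (u - 2 : ℤ) * e2
  have h9 : (1 + 3 * (1 + 8 * 1) ^ u : ℤ) = 1 + 3 ^ (2 * u + 1) := by
    rw [pow_succ, pow_mul]
    norm_num
    ring
  rw [h9] at h1
  obtain ⟨c, hc⟩ := (h1.symm.trans h2).dvd
  refine Int.modEq_iff_dvd.mpr ⟨c, ?_⟩
  have h4 : (2 : ℤ) ^ (a + 10) = 4 * 2 ^ (a + 8) := by ring
  rw [h4] at hc
  refine mul_left_cancel₀ (four_ne_zero (α := ℤ)) ?_
  linear_combination hc - 640 * e2 + (96 * e2 + 256 * e3) * eulerE (2 * u)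

lemma eulerE_modEq_of_dvd {a u : ℕ} (hu : 2 ^ a ∣ u) {p : ℤ}
    (hp : (2 : ℤ) ^ (a + 8) ∣ (1 + 6 * u + 24 * u * (u - 1) + 64 * u * (u - 1) * (u - 2)) * p -
      (1 - 8 * u + 160 * u * (u - 1))) :
    eulerE (2 * u) ≡ p [ZMOD 2 ^ (a + 8)] := by
  have h := (mul_eulerE_modEq hu).trans (Int.modEq_iff_dvd.mpr hp)
  rw [Int.modEq_iff_dvd] at h ⊢
  rw [← mul_sub] at h
  refine (IsCoprime.pow_left ?_).dvd_of_dvd_mul_left h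
  refine ⟨-(3 * u + 12 * u * (u - 1) + 32 * u * (u - 1) * (u - 2)), 1, ?_⟩
  ring

theorem eulerE_two_pow_mul (k m : ℕ) (hk : 0 < k) (hm : 2 ≤ m) :
    (m = 2 → eulerE (4 * k) ≡
        4 * k * (-48 * (k : ℤ) ^ 2 + 60 * k - 11) + 1 [ZMOD 2 ^ 9]) ∧
    (3 ≤ m → eulerE (2 ^ m * k) ≡
        2 ^ m * (k : ℤ) * (-11 + 7 * 2 ^ m * k) + 1 [ZMOD 2 ^ (m + 7)]) := by
  constructor
  · rintro rfl
    rw [show 4 * k = 2 * (2 * k) by ring]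
    refine eulerE_modEq_of_dvd (a := 1) (dvd_mul_right _ _) ?_
    push_cast
    obtain ⟨y, hy⟩ := Int.even_mul_succ_self (k : ℤ)
    refine ⟨k - 21 * k ^ 2 + 161 * k ^ 3 - 442 * k ^ 4 + 492 * k ^ 5 - 192 * k ^ 6 + k ^ 2 * y,
      ?_⟩
    linear_combination 256 * (k : ℤ) ^ 2 * hy
  · intro hm
    obtain ⟨a, rfl⟩ : ∃ a, m = a + 3 := ⟨m - 3, by omega⟩
    rw [show 2 ^ (a + 3) * k = 2 * (2 ^ (a + 2) * k) by ring]
    have h := eulerE_modEq_of_dvd (a := a + 2) (dvd_mul_right _ k)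
      (p := 2 ^ (a + 3) * (k : ℤ) * (-11 + 7 * 2 ^ (a + 3) * k) + 1) ?_
    · exact h
    obtain ⟨w, hw⟩ : ∃ w : ℤ, w = 2 ^ a * k := ⟨_, rfl⟩
    obtain ⟨y, hy⟩ := Int.even_mul_succ_self w
    push_cast
    rw [show (2 : ℤ) ^ (a + 2) * k = 4 * w by rw [hw]; ring,
      show (2 : ℤ) ^ (a + 3) * k * (-11 + 7 * 2 ^ (a + 3) * k) = 8 * w * (-11 + 56 * w) by
        rw [hw]; ring]
    refine ⟨k * (1 - 43 * w + 427 * w ^ 2 - 1528 * w ^ 3 + 1792 * w ^ 4 + y), ?_⟩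
    rw [show (2 : ℤ) ^ (a + 2 + 8) *
        (k * (1 - 43 * w + 427 * w ^ 2 - 1528 * w ^ 3 + 1792 * w ^ 4 + y))
      = 1024 * w * (1 - 43 * w + 427 * w ^ 2 - 1528 * w ^ 3 + 1792 * w ^ 4 + y) by rw [hw]; ring]
    linear_combination 512 * w * hy
end
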